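/- arXiv:1106.3758 — 2 statements merged into one kernel-verified Lean document; each statement's English description precedes it below -/
import Mathlib

section
/- For every n ∈ ℤ and every m ∈ ℕ, the identity F_m(z)·x_n = x_{n+m} + x_{n−m} holds in K. (This is a Kronecker-quiver instance of the higher difference property F_m(X_δ) = X_{M_m} − X_{N_m} used in the proof that the loop element x_{z_m} equals F_m(X_δ).) -/
noncomputable section

/-- The ambient field `K = ℚ(a,b)`, the field of rational functions in two
independent variables over `ℚ`. -/
abbrev K : Type := FractionRing (MvPolynomial (Fin 2) ℚ)

/-- The first variable `a`. -/
def a : K := algebraMap (MvPolynomial (Fin 2) ℚ) K (MvPolynomial.X 0)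

/-- The second variable `b`. -/
def b : K := algebraMap (MvPolynomial (Fin 2) ℚ) K (MvPolynomial.X 1)

/-- Forward Kronecker sequence: `fwd n = x_n` for `n ≥ 0`, with
`x_0 = a`, `x_1 = b` and `x_{n+1} = (x_n² + 1)/x_{n−1}`. -/
def fwd : ℕ → K
  | 0 => a
  | 1 => b
  | n + 2 => (fwd (n + 1) ^ 2 + 1) / fwd n

/-- Backward Kronecker sequence: `bwd n = x_{-n}` for `n ≥ 0`, using
`x_{n−1} = (x_n² + 1)/x_{n+1}` for `n ≤ 0`. -/
def bwd : ℕ → K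
  | 0 => a
  | 1 => (a ^ 2 + 1) / b
  | n + 2 => (bwd (n + 1) ^ 2 + 1) / bwd n

/-- The Kronecker cluster variables `x : ℤ → K` of the coefficient-free cluster
algebra of type `Ã_{1,1}`. -/
def xK (n : ℤ) : K := if 0 ≤ n then fwd n.toNat else bwd (-n).toNat

/-- The element attached to the simple loop in the annulus `C_{1,1}`:
`z = (1 + a² + b²)/(a·b)`. -/
def zK : K := (1 + a ^ 2 + b ^ 2) / (a * b)

/-- The `m`-th normalised Chebyshev polynomial of the first kind:
`F_0 = 2`, `F_1 = X`, `F_{m+1} = X·F_m − F_{m−1}`. -/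
def chebF : ℕ → Polynomial ℤ
  | 0 => 2
  | 1 => Polynomial.X
  | n + 2 => Polynomial.X * chebF (n + 1) - chebF n

/-- The element `-1` is not a square in `K`. -/
theorem sq_add_one_ne_zero (y : K) : y ^ 2 + 1 ≠ 0 := by
  intro h
  have hy : IsIntegral (MvPolynomial (Fin 2) ℚ) y := by
    refine ⟨Polynomial.X ^ 2 + 1, by monicity!, ?_⟩
    simpa using h
  obtain ⟨p, rfl⟩ := IsIntegrallyClosed.isIntegral_iff.mp hy
  have hp : p ^ 2 + 1 = 0 := by
    apply IsFractionRing.injective (MvPolynomial (Fin 2) ℚ) K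
    simpa using h
  have hq := congrArg (MvPolynomial.eval (0 : Fin 2 → ℚ)) hp
  simp only [map_add, map_pow, map_one, map_zero] at hq
  exact absurd hq (by positivity)

theorem a_ne_zero : a ≠ 0 := by
  simp [a]

theorem b_ne_zero : b ≠ 0 := by
  simp [b]

/-- A sequence with nonzero initial terms satisfying the exchange relation never vanishes. -/
theorem exchange_ne_zero {u : ℕ → K} (h0 : u 0 ≠ 0) (h1 : u 1 ≠ 0)
    (hu : ∀ n, u (n + 2) = (u (n + 1) ^ 2 + 1) / u n) (n : ℕ) : u n ≠ 0 := by
  induction n using Nat.twoStepInduction with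
  | zero => exact h0
  | one => exact h1
  | more n ih _ => exact hu n ▸ div_ne_zero (sq_add_one_ne_zero _) ih

/-- The exchange relation has `(1 + uₙ² + uₙ₊₁²) / (uₙ uₙ₊₁)` as a conserved quantity. -/
theorem exchange_invariant {u : ℕ → K} {z : K} (h0 : u 0 ≠ 0) (h1 : u 1 ≠ 0)
    (hu : ∀ n, u (n + 2) = (u (n + 1) ^ 2 + 1) / u n)
    (hz : z * (u 0 * u 1) = 1 + u 0 ^ 2 + u 1 ^ 2) (n : ℕ) :
    z * (u n * u (n + 1)) = 1 + u n ^ 2 + u (n + 1) ^ 2 := by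
  induction n with
  | zero => exact hz
  | succ n ih =>
    have hn := exchange_ne_zero h0 h1 hu n
    rw [hu n]
    field_simp
    linear_combination (u (n + 1) ^ 2 + 1) * ih

/-- The exchange relation linearises to a three-term recurrence. -/
theorem exchange_linear {u : ℕ → K} {z : K} (h0 : u 0 ≠ 0) (h1 : u 1 ≠ 0)
    (hu : ∀ n, u (n + 2) = (u (n + 1) ^ 2 + 1) / u n)
    (hz : z * (u 0 * u 1) = 1 + u 0 ^ 2 + u 1 ^ 2) (n : ℕ) :
    z * u (n + 1) = u (n + 2) + u n := by
  have hn := exchange_ne_zero h0 h1 hu n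
  have hi := exchange_invariant h0 h1 hu hz n
  rw [hu n]
  field_simp
  linear_combination hi

theorem zK_mul_fwd (n : ℕ) : zK * fwd (n + 1) = fwd (n + 2) + fwd n := by
  have ha := a_ne_zero
  have hb := b_ne_zero
  refine exchange_linear (by simpa [fwd]) (by simpa [fwd]) (fun n => by rw [fwd]) ?_ n
  simp only [fwd, zK]
  field_simp

theorem zK_mul_bwd (n : ℕ) : zK * bwd (n + 1) = bwd (n + 2) + bwd n := by
  have ha := a_ne_zero
  have hb := b_ne_zero
  refine exchange_linear (by simpa [bwd]) ?_ (fun n => by rw [bwd]) ?_ n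
  · simpa only [bwd] using div_ne_zero (sq_add_one_ne_zero a) hb
  · simp only [bwd, zK]
    field_simp
    ring

theorem xK_natCast (n : ℕ) : xK n = fwd n := by
  simp [xK]

theorem xK_neg_natCast (n : ℕ) : xK (-n) = bwd n := by
  cases n with
  | zero => simp [xK, fwd, bwd]
  | succ n =>
    rw [xK, if_neg (by omega)]
    simp

theorem zK_mul_xK_zero : zK * xK 0 = xK 1 + xK (-1) := by
  have ha := a_ne_zero
  have hb := b_ne_zero
  have h1 : xK 1 = b := by simpa [fwd] using xK_natCast 1
  have h0 : xK 0 = a := by simpa [fwd] using xK_natCast 0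
  have h2 : xK (-1) = (a ^ 2 + 1) / b := by simpa [bwd] using xK_neg_natCast 1
  rw [h0, h1, h2, zK]
  field_simp
  ring

/-- The difference property: the cluster variables satisfy a linear recurrence. -/
theorem zK_mul_xK (n : ℤ) : zK * xK n = xK (n + 1) + xK (n - 1) := by
  obtain ⟨k, rfl | rfl⟩ := n.eq_nat_or_neg
  · cases k with
    | zero => simpa using zK_mul_xK_zero
    | succ k =>
      have h := zK_mul_fwd k
      simp only [← xK_natCast] at h
      rw [h]
      congr 2
      push_cast
      ring
  · cases k with
    | zero => simpa using zK_mul_xK_zero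
    | succ k =>
      have h := zK_mul_bwd k
      simp only [← xK_neg_natCast] at h
      rw [h, add_comm]
      congr 2
      push_cast
      ring

/-- The higher difference property in the Kronecker case: for every `n ∈ ℤ` and
every `m ∈ ℕ`, `F_m(z)·x_n = x_{n+m} + x_{n−m}` holds in `K`. -/
theorem higher_difference_property (n : ℤ) (m : ℕ) :
    Polynomial.aeval zK (chebF m) * xK n = xK (n + m) + xK (n - m) := by
  induction m using Nat.twoStepInduction with
  | zero =>
    rw [chebF, map_ofNat]
    simp [two_mul]
  | one => simpa [chebF] using zK_mul_xK n
  | more m ih ih_succ =>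
    have hp := zK_mul_xK (n + (m + 1 : ℕ))
    have hm := zK_mul_xK (n - (m + 1 : ℕ))
    rw [show n + ((m + 1 : ℕ) : ℤ) + 1 = n + (m + 2 : ℕ) by push_cast; ring,
      show n + ((m + 1 : ℕ) : ℤ) - 1 = n + m by push_cast; ring] at hp
    rw [show n - ((m + 1 : ℕ) : ℤ) + 1 = n - m by push_cast; ring,
      show n - ((m + 1 : ℕ) : ℤ) - 1 = n - (m + 2 : ℕ) by push_cast; ring] at hm
    simp only [chebF, map_sub, map_mul, Polynomial.aeval_X]
    linear_combination zK * ih_succ - ih + hp + hm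
end
end

section
/- Let A be the subring of K generated by {x_n : n ∈ ℤ} (the coefficient-free cluster algebra of type Ã_{1,1}). Then the set B = {x_n^p·x_{n+1}^q : n ∈ ℤ, p, q ∈ ℕ} ∪ {F_m(z) : m ≥ 1} is a ℤ-linear basis of A: B is ℤ-linearly independent and the ℤ-span of B equals A. (This is property (B1) of the theorem that B_Q is the atomic basis, in the case p = q = 1.) -/
noncomputable section

/-- The set `B = {x_n^p·x_{n+1}^q : n ∈ ℤ, p, q ∈ ℕ} ∪ {F_m(z) : m ≥ 1}`. -/
def atomicSet : Set K :=
  {y | ∃ (n : ℤ) (p q : ℕ), y = xK n ^ p * xK (n + 1) ^ q} ∪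
    {y | ∃ m : ℕ, 1 ≤ m ∧ y = Polynomial.aeval zK (chebF m)}

/-- Hahn series over a domain with pairwise distinct orders are linearly independent. -/
theorem HahnSeries.linearIndependent_of_order_injective {ι Γ R : Type*} [LinearOrder Γ] [Zero Γ]
    [CommRing R] [NoZeroDivisors R] {f : ι → HahnSeries Γ R} (hf : ∀ i, f i ≠ 0)
    (hinj : Function.Injective fun i => (f i).order) : LinearIndependent R f := by
  classical
  rw [linearIndependent_iff']
  intro s g hg
  by_contra! hne
  obtain ⟨i₀, hi₀, hgi₀⟩ := hne
  obtain ⟨i, hi, hmin⟩ := Finset.exists_min_image (s.filter fun i => g i ≠ 0)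
    (fun i => (f i).order) ⟨i₀, by simp [hi₀, hgi₀]⟩
  rw [Finset.mem_filter] at hi
  have hcoeff := congrArg (fun y => y.coeff (f i).order) hg
  simp only [coeff_sum, coeff_smul, coeff_zero] at hcoeff
  rw [Finset.sum_eq_single_of_mem i hi.1] at hcoeff
  · rw [smul_eq_mul, mul_eq_zero, coeff_order_eq_zero] at hcoeff
    exact hcoeff.elim hi.2 (hf i)
  · intro j hj hji
    by_cases hgj : g j = 0
    · simp [hgj]
    · have hle := hmin j (by simp [hj, hgj])
      have hlt : (f i).order < (f j).order := lt_of_le_of_ne hle fun h => hji (hinj h.symm)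
      rw [coeff_eq_zero_of_lt_order hlt, smul_zero]

theorem HahnSeries.order_single_add_single {Γ R : Type*} [LinearOrder Γ] [Zero Γ] [AddMonoid R]
    {g h : Γ} (hgh : g < h) {r s : R} (hr : r ≠ 0) :
    single g r + single h s ≠ 0 ∧ (single g r + single h s).order = g := by
  have hlt : (single g r).orderTop < (single h s).orderTop := by
    rw [orderTop_single hr]
    exact lt_of_lt_of_le (WithTop.coe_lt_coe.2 hgh) orderTop_single_le
  have htop := orderTop_add_eq_left hlt
  rw [orderTop_single hr] at htop
  have hne : single g r + single h s ≠ 0 := fun h0 => by simp [h0] at htop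
  refine ⟨hne, ?_⟩
  rw [← order_eq_orderTop_of_ne_zero hne] at htop
  exact_mod_cast htop

theorem HahnSeries.single_one_zpow {Γ R : Type*} [AddCommGroup Γ] [LinearOrder Γ]
    [IsOrderedAddMonoid Γ] [Field R] (g : Γ) (n : ℤ) :
    (single g (1 : R)) ^ n = single (n • g) 1 := by
  cases n with
  | ofNat n => simp
  | negSucc n => simp [zpow_negSucc, negSucc_zsmul]

/-! ### A closed form for the Kronecker sequence -/

section ClosedForm

variable {F : Type*} [Field F]

/-- The solution `(t⁻¹ lⁿ + t l⁻ⁿ) / (l - l⁻¹)` of the Kronecker recursion. -/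
def kroneckerForm (t l : F) (n : ℤ) : F := (t⁻¹ * l ^ n + t * (l ^ n)⁻¹) / (l - l⁻¹)

theorem kroneckerForm_exchange {t l : F} (ht : t ≠ 0) (hl : l ≠ 0) (hd : l - l⁻¹ ≠ 0) (n : ℤ) :
    kroneckerForm t l n * kroneckerForm t l (n + 2) = kroneckerForm t l (n + 1) ^ 2 + 1 := by
  have hn : l ^ n ≠ 0 := zpow_ne_zero n hl
  have hd' : l ^ 2 - 1 ≠ 0 := fun h => hd (by field_simp; linear_combination h)
  simp only [kroneckerForm, zpow_add₀ hl, zpow_ofNat]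
  field_simp
  ring

theorem kroneckerForm_linear {t l : F} (ht : t ≠ 0) (hl : l ≠ 0) (hd : l - l⁻¹ ≠ 0) (n : ℤ) :
    kroneckerForm t l n + kroneckerForm t l (n + 2) = (l + l⁻¹) * kroneckerForm t l (n + 1) := by
  have hn : l ^ n ≠ 0 := zpow_ne_zero n hl
  have hd' : l ^ 2 - 1 ≠ 0 := fun h => hd (by field_simp; linear_combination h)
  simp only [kroneckerForm, zpow_add₀ hl, zpow_ofNat]
  field_simp
  ring

theorem aeval_chebF_add_inv {l : F} (hl : l ≠ 0) (m : ℕ) :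
    Polynomial.aeval (l + l⁻¹) (chebF m) = l ^ m + (l ^ m)⁻¹ := by
  induction m using Nat.twoStepInduction with
  | zero => simp [chebF, map_ofNat, one_add_one_eq_two]
  | one => simp [chebF]
  | more m h0 h1 =>
    simp only [chebF, map_sub, map_mul, Polynomial.aeval_X, h0, h1]
    field_simp
    ring

end ClosedForm

/-- Hahn series in two variables with lexicographically ordered exponents. -/
abbrev LexSeries : Type := HahnSeries (ℤ ×ₗ ℤ) ℚ

namespace LexSeries

open HahnSeries

/-- The dominant variable. -/
def t : LexSeries := single (toLex (1, 0)) 1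

/-- The minor variable. -/
def l : LexSeries := single (toLex (0, 1)) 1

theorem t_ne_zero : t ≠ 0 := single_ne_zero one_ne_zero

theorem l_ne_zero : l ≠ 0 := single_ne_zero one_ne_zero

theorem neg_toLex (i j : ℤ) : -(toLex (i, j)) = toLex (-i, -j) := rfl

theorem add_toLex (i j i' j' : ℤ) : toLex (i, j) + toLex (i', j') = toLex (i + i', j + j') := rfl

theorem zsmul_toLex (n i j : ℤ) : n • toLex (i, j) = toLex (n * i, n * j) := rfl

theorem nsmul_toLex (n : ℕ) (i j : ℤ) : n • toLex (i, j) = toLex (n * i, n * j) := by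
  rw [← natCast_zsmul, zsmul_toLex]

theorem l_zpow (n : ℤ) : l ^ n = single (toLex (0, n)) 1 := by
  rw [l, single_one_zpow]
  rw [zsmul_toLex]
  simp

theorem l_sub_inv : l - l⁻¹ ≠ 0 ∧ (l - l⁻¹).order = toLex (0, -1) := by
  have h : l - l⁻¹ = single (toLex (0, -1)) (-1 : ℚ) + single (toLex (0, 1)) 1 := by
    rw [l, inv_single, neg_toLex, single_neg, inv_one, neg_zero]
    ring
  rw [h]
  exact order_single_add_single (by simp [Prod.Lex.toLex_lt_toLex]) (by norm_num)

theorem l_pow_add_inv {m : ℕ} (hm : 1 ≤ m) :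
    l ^ m + (l ^ m)⁻¹ ≠ 0 ∧ (l ^ m + (l ^ m)⁻¹).order = toLex (0, -(m : ℤ)) := by
  rw [← zpow_natCast, l_zpow, inv_single, neg_toLex, inv_one, add_comm, neg_zero]
  exact order_single_add_single (by simp [Prod.Lex.toLex_lt_toLex]; omega) one_ne_zero

/-- The Kronecker sequence realised in `LexSeries`. -/
def x (n : ℤ) : LexSeries := kroneckerForm t l n

theorem x_ne_zero_and_order (n : ℤ) : x n ≠ 0 ∧ (x n).order = toLex (-1, n + 1) := by
  have h : x n * (l - l⁻¹) = single (toLex (-1, n)) 1 + single (toLex (1, -n)) 1 := by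
    rw [x, kroneckerForm, div_mul_cancel₀ _ l_sub_inv.1, l_zpow, t, inv_single, inv_single,
      single_mul_single, single_mul_single, neg_toLex, neg_toLex, add_toLex, add_toLex]
    simp
  obtain ⟨hne, hord⟩ := order_single_add_single (R := ℚ) (s := 1)
    (show toLex (-1, n) < toLex (1, -n) by simp [Prod.Lex.toLex_lt_toLex]) one_ne_zero
  rw [← h] at hne hord
  have hx : x n ≠ 0 := left_ne_zero_of_mul hne
  refine ⟨hx, ?_⟩
  rw [order_mul hx l_sub_inv.1, l_sub_inv.2] at hord
  rw [eq_sub_of_add_eq hord, sub_eq_add_neg, neg_toLex, add_toLex]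
  simp

theorem x_ne_zero (n : ℤ) : x n ≠ 0 := (x_ne_zero_and_order n).1

theorem order_x_pow_mul (n : ℤ) (p q : ℕ) : (x n ^ p * x (n + 1) ^ q).order =
    toLex (-((p : ℤ) + q), (n + 1) * (p + q) + q) := by
  rw [order_mul (pow_ne_zero _ (x_ne_zero _)) (pow_ne_zero _ (x_ne_zero _)), order_pow, order_pow,
    (x_ne_zero_and_order _).2, (x_ne_zero_and_order _).2, nsmul_toLex, nsmul_toLex, add_toLex]
  congr 2 <;> ring

theorem x_exchange (n : ℤ) : x n * x (n + 2) = x (n + 1) ^ 2 + 1 :=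
  kroneckerForm_exchange t_ne_zero l_ne_zero l_sub_inv.1 n

theorem x_linear (n : ℤ) : x n + x (n + 2) = (l + l⁻¹) * x (n + 1) :=
  kroneckerForm_linear t_ne_zero l_ne_zero l_sub_inv.1 n

/-- The substitution of the initial cluster by its closed form. -/
def evalInitial : MvPolynomial (Fin 2) ℚ →ₐ[ℚ] LexSeries := MvPolynomial.aeval ![x 0, x 1]

theorem evalInitial_injective : Function.Injective evalInitial := by
  have hmon (s : Fin 2 →₀ ℕ) :
      evalInitial (MvPolynomial.monomial s 1) = x 0 ^ s 0 * x (0 + 1) ^ s 1 := by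
    simp [evalInitial, MvPolynomial.aeval_monomial, Finsupp.prod_fintype, Fin.prod_univ_two]
  have hli : LinearIndependent ℚ
      (evalInitial.toLinearMap ∘ MvPolynomial.basisMonomials (Fin 2) ℚ) := by
    refine linearIndependent_of_order_injective (fun s => ?_) (fun s s' h => ?_)
    · simp [hmon, x_ne_zero]
    · simp only [Function.comp_apply, MvPolynomial.coe_basisMonomials, AlgHom.toLinearMap_apply,
        hmon, order_x_pow_mul, EmbeddingLike.apply_eq_iff_eq, Prod.mk.injEq] at h
      ext i
      fin_cases i <;> simp <;> omega
  have hker := Submodule.range_ker_disjoint hli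
  rw [Module.Basis.span_eq, top_disjoint] at hker
  exact LinearMap.ker_eq_bot.1 hker

/-- The embedding of `K` into `LexSeries`. -/
def ofK : K →+* LexSeries := IsFractionRing.lift (g := evalInitial.toRingHom) evalInitial_injective

theorem ofK_a : ofK a = x 0 := by
  simp [ofK, a, evalInitial]

theorem ofK_b : ofK b = x 1 := by
  simp [ofK, b, evalInitial]

theorem ofK_fwd (n : ℕ) : ofK (fwd n) = x n := by
  induction n using Nat.twoStepInduction with
  | zero => simpa [fwd] using ofK_a
  | one => simpa [fwd] using ofK_b
  | more n h0 h1 =>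
    rw [fwd, map_div₀, map_add, map_pow, map_one, h0, h1, div_eq_iff (x_ne_zero _)]
    push_cast
    rw [← x_exchange, mul_comm]

theorem ofK_bwd (n : ℕ) : ofK (bwd n) = x (-n) := by
  have hex (m : ℤ) : (x (m + 1) ^ 2 + 1) / x (m + 2) = x m := by
    rw [div_eq_iff (x_ne_zero _), x_exchange]
  induction n using Nat.twoStepInduction with
  | zero => simpa [bwd] using ofK_a
  | one => simpa [bwd, ofK_a, ofK_b] using hex (-1)
  | more n h0 h1 =>
    rw [bwd, map_div₀, map_add, map_pow, map_one, h0, h1, ← hex (-((n + 2 : ℕ) : ℤ))]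
    push_cast
    ring_nf

theorem ofK_xK (n : ℤ) : ofK (xK n) = x n := by
  unfold xK
  split_ifs with h
  · rw [ofK_fwd, Int.toNat_of_nonneg h]
  · rw [ofK_bwd, Int.toNat_of_nonneg (by omega), neg_neg]

theorem ofK_zK : ofK zK = l + l⁻¹ := by
  have hex := x_exchange 0
  have hlin := x_linear 0
  norm_num at hex hlin
  simp only [zK, map_div₀, map_add, map_mul, map_pow, map_one, ofK_a, ofK_b]
  rw [div_eq_iff (mul_ne_zero (x_ne_zero _) (x_ne_zero _))]
  linear_combination x 0 * hlin - hex

end LexSeries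

theorem xK_exchange (n : ℤ) : xK n * xK (n + 2) = xK (n + 1) ^ 2 + 1 :=
  LexSeries.ofK.injective (by simpa [LexSeries.ofK_xK] using LexSeries.x_exchange n)

theorem xK_linear (n : ℤ) : xK n + xK (n + 2) = zK * xK (n + 1) :=
  LexSeries.ofK.injective (by
    simpa [LexSeries.ofK_xK, LexSeries.ofK_zK] using LexSeries.x_linear n)

theorem ofK_aeval_chebF (m : ℕ) : LexSeries.ofK (Polynomial.aeval zK (chebF m)) =
    LexSeries.l ^ m + (LexSeries.l ^ m)⁻¹ := by
  rw [← aeval_chebF_add_inv LexSeries.l_ne_zero, ← LexSeries.ofK_zK, Polynomial.aeval_def,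
    Polynomial.aeval_def, Polynomial.hom_eval₂]
  congr 1
  exact RingHom.ext_int _ _

/-! ### Linear independence -/

/-- Cluster monomials with the same leading exponent coincide. -/
theorem xK_monomial_eq_of_exponent_eq {n n' : ℤ} {p q p' q' : ℕ}
    (hdeg : (p : ℤ) + q = p' + q')
    (hexp : (n + 1) * ((p : ℤ) + q) + q = (n' + 1) * (p' + q') + q') :
    xK n ^ p * xK (n + 1) ^ q = xK n' ^ p' * xK (n' + 1) ^ q' := by
  wlog hnn : n ≤ n' generalizing n n' p q p' q'
  · exact (this hdeg.symm hexp.symm (by omega)).symm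
  rw [← hdeg] at hexp
  obtain ⟨k, rfl⟩ := Int.exists_add_of_le hnn
  have hk : (k : ℤ) * (p + q) + q' = q := by linear_combination -hexp
  rcases k with _ | _ | k
  · obtain rfl : q = q' := by simp at hk; omega
    obtain rfl : p = p' := by omega
    simp
  · obtain ⟨rfl, rfl⟩ : p = 0 ∧ q' = 0 := by push_cast at hk; omega
    obtain rfl : q = p' := by omega
    simp
  · have : 0 ≤ (k : ℤ) * (p + q) := by positivity
    push_cast at hk
    obtain ⟨rfl, rfl, rfl⟩ : p = 0 ∧ q = 0 ∧ q' = 0 := by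
      refine ⟨?_, ?_, ?_⟩ <;> nlinarith
    obtain rfl : p' = 0 := by omega
    simp

theorem linearIndependent_atomicSet : LinearIndependent ℤ ((↑) : atomicSet → K) := by
  let φ : K →ₗ[ℤ] LexSeries :=
    { toFun := LexSeries.ofK
      map_add' := map_add _
      map_smul' := fun c y => map_zsmul LexSeries.ofK c y }
  refine LinearIndependent.of_comp φ ?_
  refine LinearIndependent.restrict_scalars (K := ℚ) ?_
    (HahnSeries.linearIndependent_of_order_injective ?_ ?_)
  · intro i j h
    simpa using h
  · rintro ⟨_, ⟨n, p, q, rfl⟩ | ⟨m, hm, rfl⟩⟩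
    · simp [φ, LexSeries.ofK_xK, LexSeries.x_ne_zero]
    · simpa [φ, ofK_aeval_chebF] using (LexSeries.l_pow_add_inv hm).1
  · have hx (n : ℤ) (p q : ℕ) : (LexSeries.ofK (xK n ^ p * xK (n + 1) ^ q)).order =
        toLex (-((p : ℤ) + q), (n + 1) * (p + q) + q) := by
      simp [LexSeries.ofK_xK, LexSeries.order_x_pow_mul]
    have hF (m : ℕ) (hm : 1 ≤ m) : (LexSeries.ofK (Polynomial.aeval zK (chebF m))).order =
        toLex (0, -(m : ℤ)) := by
      rw [ofK_aeval_chebF, (LexSeries.l_pow_add_inv hm).2]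
    have hmix (n : ℤ) (p q m : ℕ) (hm : 1 ≤ m) :
        toLex (-((p : ℤ) + q), (n + 1) * ((p : ℤ) + q) + q) ≠ toLex (0, -(m : ℤ)) := by
      intro h
      rw [EmbeddingLike.apply_eq_iff_eq, Prod.mk.injEq] at h
      obtain ⟨rfl, rfl⟩ : p = 0 ∧ q = 0 := by omega
      simp at h
      omega
    rintro ⟨_, ⟨n, p, q, rfl⟩ | ⟨m, hm, rfl⟩⟩ ⟨_, ⟨n', p', q', rfl⟩ | ⟨m', hm', rfl⟩⟩ h <;>
      apply Subtype.ext <;>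
      change (LexSeries.ofK _).order = (LexSeries.ofK _).order at h <;>
      dsimp only
    · rw [hx, hx, EmbeddingLike.apply_eq_iff_eq, Prod.mk.injEq] at h
      exact xK_monomial_eq_of_exponent_eq (neg_injective h.1) h.2
    · rw [hx, hF _ hm'] at h
      exact absurd h (hmix _ _ _ _ hm')
    · rw [hx, hF _ hm] at h
      exact absurd h.symm (hmix _ _ _ _ hm)
    · rw [hF _ hm, hF _ hm', EmbeddingLike.apply_eq_iff_eq, Prod.mk.injEq] at h
      obtain rfl : m = m' := by omega
      rfl

/-! ### The span of the atomic set -/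

theorem xK_mul_xK_add (d : ℕ) (n : ℤ) : ∃ p : Polynomial ℤ,
    xK n * xK (n + d + 1) = xK (n + 1) * xK (n + d) + Polynomial.aeval zK p := by
  induction d using Nat.twoStepInduction with
  | zero => exact ⟨0, by simp [mul_comm]⟩
  | one =>
    refine ⟨1, ?_⟩
    have h := xK_exchange n
    rw [show n + ((1 : ℕ) : ℤ) + 1 = n + 2 by push_cast; ring, h]
    simp [sq]
  | more d h0 h1 =>
    obtain ⟨p, hp⟩ := h0
    obtain ⟨r, hr⟩ := h1
    refine ⟨Polynomial.X * r - p, ?_⟩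
    have h2 := xK_linear (n + d)
    have h3 := xK_linear (n + d + 1)
    simp only [map_sub, map_mul, Polynomial.aeval_X]
    push_cast at hr ⊢
    rw [show n + ((d : ℤ) + 1) + 1 = n + d + 2 by ring, show n + ((d : ℤ) + 1) = n + d + 1 by ring]
      at hr
    rw [show n + ((d : ℤ) + 2) + 1 = n + d + 1 + 2 by ring,
      show n + ((d : ℤ) + 2) = n + d + 2 by ring]
    rw [show n + (d : ℤ) + 1 + 1 = n + d + 2 by ring] at h3
    linear_combination xK n * h3 - xK (n + 1) * h2 + zK * hr - hp

theorem xK_pow_mul_mem_span (n : ℤ) (p q : ℕ) :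
    xK n ^ p * xK (n + 1) ^ q ∈ Submodule.span ℤ atomicSet :=
  Submodule.subset_span (Or.inl ⟨n, p, q, rfl⟩)

theorem one_mem_span_atomicSet : (1 : K) ∈ Submodule.span ℤ atomicSet := by
  simpa using xK_pow_mul_mem_span 0 0 0

theorem aeval_chebF_mem_span (m : ℕ) :
    Polynomial.aeval zK (chebF m) ∈ Submodule.span ℤ atomicSet := by
  rcases Nat.eq_zero_or_pos m with rfl | hm
  · simpa [chebF, map_ofNat, one_add_one_eq_two] using add_mem one_mem_span_atomicSet one_mem_span_atomicSet
  · exact Submodule.subset_span (Or.inr ⟨m, hm, rfl⟩)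

theorem zK_pow_mem_span (i : ℕ) : zK ^ i ∈ Submodule.span ℤ atomicSet := by
  suffices h : zK ^ i ∈ Submodule.span ℤ
      (insert 1 (Set.range fun m => Polynomial.aeval zK (chebF m))) by
    refine Submodule.span_le.2 ?_ h
    rintro _ (rfl | ⟨m, rfl⟩)
    · exact one_mem_span_atomicSet
    · exact aeval_chebF_mem_span m
  set S := Submodule.span ℤ (insert 1 (Set.range fun m => Polynomial.aeval zK (chebF m)))
  have hF (m : ℕ) : Polynomial.aeval zK (chebF m) ∈ S :=
    Submodule.subset_span (Or.inr ⟨m, rfl⟩)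
  induction i with
  | zero => simpa using (Submodule.subset_span (Or.inl rfl) : (1 : K) ∈ S)
  | succ i ih =>
    have hle : S ≤ S.comap (LinearMap.mulLeft ℤ zK) := by
      refine Submodule.span_le.2 ?_
      rintro _ (rfl | ⟨m, rfl⟩)
      · simpa [chebF] using hF 1
      · rcases m with _ | m
        · simpa [chebF, map_ofNat, mul_two] using add_mem (hF 1) (hF 1)
        · simpa [chebF] using add_mem (hF (m + 2)) (hF m)
    rw [pow_succ']
    exact hle ih

/-- If products of `k` cluster variables lie in the span, so do their multiples by polynomials
in `z`. -/
theorem aeval_mul_prod_mem_span {k : ℕ}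
    (hk : ∀ s : Multiset ℤ, s.card = k → (s.map xK).prod ∈ Submodule.span ℤ atomicSet)
    (p : Polynomial ℤ) (s : Multiset ℤ) (hs : s.card = k) :
    Polynomial.aeval zK p * (s.map xK).prod ∈ Submodule.span ℤ atomicSet := by
  have hpow (i : ℕ) : ∀ s : Multiset ℤ, s.card = k →
      zK ^ i * (s.map xK).prod ∈ Submodule.span ℤ atomicSet := by
    induction i with
    | zero => simpa using hk
    | succ i ih =>
      intro s hs
      rcases s.empty_or_exists_mem with rfl | ⟨n, hn⟩
      · simpa using zK_pow_mem_span (i + 1)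
      · obtain ⟨s, rfl⟩ := Multiset.exists_cons_of_mem hn
        have h := add_mem (ih ((n - 1) ::ₘ s) (by simpa using hs))
          (ih ((n + 1) ::ₘ s) (by simpa using hs))
        have hlin := xK_linear (n - 1)
        rw [show n - 1 + 2 = n + 1 by ring, sub_add_cancel] at hlin
        simp only [Multiset.map_cons, Multiset.prod_cons] at h ⊢
        convert h using 1
        linear_combination -zK ^ i * (s.map xK).prod * hlin
  induction p using Polynomial.induction_on' with
  | add p r hp hr => simpa [add_mul] using add_mem hp hr
  | monomial i c =>
    rw [Polynomial.aeval_monomial, mul_assoc]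
    simpa using Submodule.smul_mem _ c (hpow i s hs)

/-- A multiset of integers of diameter at most one is supported on two consecutive integers. -/
theorem Multiset.eq_replicate_add_replicate_of_diam_le_one (s : Multiset ℤ)
    (hs : ∀ i ∈ s, ∀ j ∈ s, j ≤ i + 1) :
    ∃ (n : ℤ) (p q : ℕ), s = replicate p n + replicate q (n + 1) := by
  rcases s.empty_or_exists_mem with rfl | ⟨i, hi⟩
  · exact ⟨0, 0, 0, by simp⟩
  obtain ⟨n, hn, hmin⟩ := s.toFinset.exists_min_image id ⟨i, by simpa using hi⟩
  simp only [mem_toFinset, id] at hn hmin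
  refine ⟨n, _, _, (filter_add_not (fun j => j = n) s).symm.trans (congrArg₂ _
    (eq_replicate_card.2 fun j hj => (mem_filter.1 hj).2)
    (eq_replicate_card.2 fun j hj => ?_))⟩
  obtain ⟨hjs, hjn⟩ := mem_filter.1 hj
  have := hmin j hjs
  have := hs n hn j hjs
  omega

theorem prod_xK_mem_span (s : Multiset ℤ) :
    (s.map xK).prod ∈ Submodule.span ℤ atomicSet := by
  obtain ⟨k, hk⟩ : ∃ k, s.card = k := ⟨_, rfl⟩
  induction k using Nat.strong_induction_on generalizing s with
  | _ k ihk =>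
  obtain ⟨N, hN⟩ : ∃ N, (s.map fun i => i.natAbs ^ 2).sum = N := ⟨_, rfl⟩
  induction N using Nat.strong_induction_on generalizing s with
  | _ N ihN =>
  by_cases hdiam : ∀ i ∈ s, ∀ j ∈ s, j ≤ i + 1
  · obtain ⟨n, p, q, rfl⟩ := s.eq_replicate_add_replicate_of_diam_le_one hdiam
    simpa using xK_pow_mul_mem_span n p q
  · push Not at hdiam
    obtain ⟨n, hn, m, hm, hnm⟩ := hdiam
    obtain ⟨s, rfl⟩ := Multiset.exists_cons_of_mem hn
    rw [Multiset.mem_cons, or_iff_right (by omega)] at hm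
    obtain ⟨s, rfl⟩ := Multiset.exists_cons_of_mem hm
    obtain ⟨d, rfl⟩ : ∃ d : ℕ, m = n + d + 1 := ⟨(m - n - 1).toNat, by omega⟩
    have hd : (1 : ℤ) ≤ d := by omega
    obtain ⟨p, hp⟩ := xK_mul_xK_add d n
    simp only [Multiset.map_cons, Multiset.prod_cons, Multiset.card_cons, Multiset.sum_cons]
      at hk hN ⊢
    rw [← mul_assoc, hp, add_mul, mul_assoc]
    refine add_mem ?_ ?_
    · have hlt : ((n + 1).natAbs ^ 2 + ((n + d).natAbs ^ 2 +
          (s.map fun i => i.natAbs ^ 2).sum)) < N := by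
        rw [← hN]
        zify
        simp only [sq_abs]
        nlinarith
      simpa using ihN _ hlt ((n + 1) ::ₘ (n + d) ::ₘ s) (by simpa using hk) (by simp)
    · exact aeval_mul_prod_mem_span (ihk s.card (by omega)) p s rfl

theorem zK_mem_closure : zK ∈ Subring.closure (Set.range xK) := by
  have hx (n : ℤ) : xK n ∈ Subring.closure (Set.range xK) := Subring.subset_closure ⟨n, rfl⟩
  have hz : zK = xK 0 * xK 3 - xK 1 * xK 2 := by
    have h0 := xK_exchange 0
    have h1 := xK_linear 0
    have h2 := xK_linear 1
    norm_num at h0 h1 h2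
    linear_combination -zK * h0 - xK 0 * h2 + xK 1 * h1
  rw [hz]
  exact sub_mem (mul_mem (hx _) (hx _)) (mul_mem (hx _) (hx _))

theorem span_atomicSet_eq_closure : (Submodule.span ℤ atomicSet : Set K) =
    (Subring.closure (Set.range xK) : Set K) := by
  have hx (n : ℤ) : xK n ∈ Subring.closure (Set.range xK) := Subring.subset_closure ⟨n, rfl⟩
  apply Set.Subset.antisymm
  · intro y hy
    refine Submodule.span_induction ?_ (zero_mem _) (fun _ _ _ _ => add_mem)
      (fun c _ _ h => zsmul_mem h c) hy
    rintro _ (⟨n, p, q, rfl⟩ | ⟨m, -, rfl⟩)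
    · exact mul_mem (pow_mem (hx _) _) (pow_mem (hx _) _)
    · rw [Polynomial.aeval_eq_sum_range]
      refine sum_mem fun i _ => ?_
      rw [Algebra.smul_def, eq_intCast]
      exact mul_mem (intCast_mem _ _) (pow_mem zK_mem_closure i)
  · intro y hy
    rw [SetLike.mem_coe, Subring.mem_closure_iff, ← SetLike.mem_coe] at hy
    refine AddSubgroup.closure_induction ?_ (zero_mem _) (fun _ _ _ _ => add_mem)
      (fun _ _ => neg_mem) hy
    intro w hw
    obtain ⟨s, hs, rfl⟩ := Submonoid.exists_multiset_of_mem_closure hw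
    have : CanLift K ℤ xK (· ∈ Set.range xK) := ⟨fun _ h => h⟩
    lift s to Multiset ℤ using hs
    exact prod_xK_mem_span s

/-- `B` is a `ℤ`-linear basis of the coefficient-free cluster algebra `A` of type
`Ã_{1,1}` (the subring of `K` generated by the cluster variables): `B` is
`ℤ`-linearly independent and the `ℤ`-span of `B` equals `A`. -/
theorem atomicSet_is_basis :
    LinearIndependent ℤ ((↑) : atomicSet → K) ∧
    (Submodule.span ℤ atomicSet : Set K) =
      (Subring.closure (Set.range xK) : Set K) :=
  ⟨linearIndependent_atomicSet, span_atomicSet_eq_closure⟩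
end
end
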